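/- arXiv:0704.0416 — 2 statements merged into one kernel-verified Lean document; each statement's English description precedes it below -/
import Mathlib

section
/- For the sequence of subgroups Hₙ built from U_L as in Setting A, the Veech groups are pairwise distinct: for all n, m ≥ 1 with n ≠ m, Γ(Hₙ) ≠ Γ(H_m). -/
/-- The free group on two generators. -/
abbrev F2 := FreeGroup (Fin 2)

/-- The generator `x` of `F₂`. -/
def xg : F2 := FreeGroup.of 0

/-- The generator `y` of `F₂`. -/
def yg : F2 := FreeGroup.of 1

/-- The exponent sum of the `i`-th generator, i.e. the `i`-th coordinate of the image in the
abelianization `ℤ²` of `F₂`. -/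
def expSum (i : Fin 2) : F2 →* Multiplicative ℤ :=
  FreeGroup.lift fun j => Multiplicative.ofAdd (if j = i then (1 : ℤ) else 0)

/-- The matrix in `GL₂(ℤ)` induced by an automorphism `γ` of `F₂` on the abelianization
`F₂^ab ≅ ℤ²` (with basis the images of `x` and `y`); i.e. `β̂(γ)`. -/
def autMat (γ : F2 ≃* F2) : Matrix (Fin 2) (Fin 2) ℤ :=
  Matrix.of fun i j => Multiplicative.toAdd (expSum i (γ (FreeGroup.of j)))

abbrev SL2Z := Matrix.SpecialLinearGroup (Fin 2) ℤ

/-- `Stab(V) = {γ ∈ Aut⁺(F₂) : γ(V) = V}`. -/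
def StabSet (V : Subgroup F2) : Set (F2 ≃* F2) :=
  { γ | (autMat γ).det = 1 ∧ Subgroup.map γ.toMonoidHom V = V }

/-- The Veech group `Γ(V) = β̂(Stab(V)) ⊆ SL₂(ℤ)` of a subgroup `V` of `F₂`. -/
def VeechGroup (V : Subgroup F2) : Set SL2Z :=
  { A | ∃ γ : F2 ≃* F2, γ ∈ StabSet V ∧ (A : Matrix (Fin 2) (Fin 2) ℤ) = autMat γ }

/-- A set of elements of `SL₂(ℤ)` is a congruence group if it contains the principal congruence
subgroup `Γ(n)` for some `n ≥ 1`. -/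
def IsCongruenceSet (S : Set SL2Z) : Prop :=
  ∃ n : ℕ, 1 ≤ n ∧ (CongruenceSubgroup.Gamma n : Set SL2Z) ⊆ S

/-- The subgroup of `Multiplicative ℤ` of elements divisible by `n`. -/
def divSub (n : ℤ) : Subgroup (Multiplicative ℤ) where
  carrier := {d | n ∣ Multiplicative.toAdd d}
  one_mem' := dvd_zero n
  mul_mem' := fun ha hb => dvd_add ha hb
  inv_mem' := fun ha => dvd_neg.mpr ha

/-- The subgroup `Hₙ = {u ∈ U : n ∣ α(u)}` of `F₂` (for `n = 0` this is `ker α = H₀`). -/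
def Hgrp {U : Subgroup F2} (α : U →* Multiplicative ℤ) (n : ℕ) : Subgroup F2 :=
  Subgroup.map U.subtype (Subgroup.comap α (divSub (n : ℤ)))

/-- The subgroup `U_L` of `F₂` corresponding to the origami `L(2,3)`. -/
def UL : Subgroup F2 :=
  Subgroup.closure {xg ^ 3, xg * yg * xg⁻¹, xg ^ 2 * yg * (xg ^ 2)⁻¹, yg * xg * yg⁻¹, yg ^ 2}

/-- The subgroup `U_D` of `F₂` corresponding to the origami `D`. -/
def UD : Subgroup F2 :=
  Subgroup.closure {xg ^ 3, xg * yg * (xg ^ 2)⁻¹, xg ^ 2 * yg * xg⁻¹, yg * xg * yg⁻¹,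
    yg ^ 2 * xg * (yg ^ 2)⁻¹, yg ^ 3}

namespace FreeGroup

variable {α : Type*} [DecidableEq α]

/-- The length of the longest common prefix of two lists. -/
def lcpLength {γ : Type*} [DecidableEq γ] : List γ → List γ → ℕ
  | a :: l, b :: m => if a = b then lcpLength l m + 1 else 0
  | _, _ => 0

theorem lcpLength_min_le {γ : Type*} [DecidableEq γ] (l m k : List γ) :
    min (lcpLength l m) (lcpLength m k) ≤ lcpLength l k := by
  induction l generalizing m k with
  | nil => simp [lcpLength]
  | cons a l ih =>
    rcases m with _ | ⟨b, m⟩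
    · simp [lcpLength]
    rcases k with _ | ⟨c, k⟩
    · simp [lcpLength]
    have := ih m k
    simp only [lcpLength]
    split_ifs <;> grind

theorem length_reduce_invRev_append {l m : List (α × Bool)} (hl : IsReduced l)
    (hm : IsReduced m) :
    (reduce (invRev l ++ m)).length + 2 * lcpLength l m = l.length + m.length := by
  have key : ∀ l m : List (α × Bool), IsReduced l → IsReduced m → lcpLength l m = 0 →
      (reduce (invRev l ++ m)).length = l.length + m.length := by
    intro l m hl hm h
    rcases l with _ | ⟨a, l⟩
    · simp [hm.reduce_eq]
    rcases m with _ | ⟨b, m⟩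
    · simp [reduce_invRev, hl.reduce_eq, invRev_length]
    have hab : a ≠ b := by
      rintro rfl
      simp [lcpLength] at h
    have h1 : IsReduced (invRev l ++ [(a.1, !a.2)]) := by
      have : IsReduced (invRev (a :: l)) := by
        rw [isReduced_iff_reduce_eq, reduce_invRev, hl.reduce_eq]
      simpa [invRev] using this
    have h2 : IsReduced ([(a.1, !a.2)] ++ b :: m) := by
      rw [List.singleton_append, isReduced_cons_cons]
      refine ⟨fun h => ?_, hm⟩
      rcases a with ⟨a, _ | _⟩ <;> rcases b with ⟨b, _ | _⟩ <;> simp_all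
    have := (h1.append_overlap h2 (by simp)).reduce_eq
    rw [invRev_cons, show invRev [a] = [(a.1, !a.2)] by simp [invRev], this]
    simp [invRev_length]
    omega
  induction l generalizing m with
  | nil => simpa [lcpLength] using key [] m hl hm (by simp [lcpLength])
  | cons a l ih =>
    rcases m with _ | ⟨b, m⟩
    · simpa [lcpLength] using key (a :: l) [] hl hm (by simp [lcpLength])
    by_cases hab : a = b
    · subst hab
      have h := ih (m := m) (hl.infix ⟨[a], [], by simp⟩) (hm.infix ⟨[a], [], by simp⟩)
      have : reduce (invRev (a :: l) ++ a :: m) = reduce (invRev l ++ m) := by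
        apply reduce.sound
        simp only [← mul_mk, ← inv_mk]
        rw [show a :: l = [a] ++ l from rfl, show a :: m = [a] ++ m from rfl]
        simp only [← mul_mk]
        group
      rw [this]
      simp [lcpLength]
      omega
    · have h0 : lcpLength (a :: l) (b :: m) = 0 := by simp [lcpLength, hab]
      rw [key _ _ hl hm h0, h0]
      simp

/-- The length of the longest common prefix of the reduced words of two elements. -/
def lcp (a b : FreeGroup α) : ℕ := lcpLength a.toWord b.toWord

theorem norm_inv_mul_add (a b : FreeGroup α) :
    norm (a⁻¹ * b) + 2 * lcp a b = norm a + norm b := by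
  have := length_reduce_invRev_append (isReduced_toWord (x := a)) (isReduced_toWord (x := b))
  simpa [norm, lcp, toWord_mul, toWord_inv] using this

theorem norm_mul_add (a b : FreeGroup α) :
    norm (a * b) + 2 * lcp a⁻¹ b = norm a + norm b := by
  simpa using norm_inv_mul_add a⁻¹ b

theorem lcp_comm (a b : FreeGroup α) : lcp a b = lcp b a := by
  have h1 := norm_inv_mul_add a b
  have h2 := norm_inv_mul_add b a
  have h3 : norm (b⁻¹ * a) = norm (a⁻¹ * b) := by
    rw [← norm_inv_eq, mul_inv_rev, inv_inv]
  omega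

theorem lcp_min_le (a b c : FreeGroup α) : min (lcp a b) (lcp b c) ≤ lcp a c :=
  lcpLength_min_le _ _ _

theorem exists_norm_one_lcp {a : FreeGroup α} (ha : a ≠ 1) :
    ∃ z : FreeGroup α, norm z = 1 ∧ 1 ≤ lcp z a := by
  rcases h : a.toWord with _ | ⟨p, l⟩
  · exact absurd (toWord_eq_nil_iff.1 h) ha
  · refine ⟨mk [p], by simp [norm], ?_⟩
    simp [lcp, h, lcpLength]

theorem two_mul_lcp_inv_self_lt {a : FreeGroup α} (ha : a ≠ 1) :
    2 * lcp a⁻¹ a < norm a := by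
  have h := norm_mul_add a a
  have h1 := reduceCyclically.reduce_flatten_replicate_succ (isReduced_toWord (x := a)) 1
  have h2 := congrArg List.length
    (reduceCyclically.conj_conjugator_reduceCyclically a.toWord)
  have h3 : norm (a * a) = (reduce (List.replicate (1 + 1) a.toWord).flatten).length := by
    simp [norm, toWord_mul, List.replicate]
  have h4 : (reduceCyclically a.toWord).length ≠ 0 := by
    intro h0
    rw [List.length_eq_zero_iff] at h0
    have h5 := reduceCyclically.conj_conjugator_reduceCyclically a.toWord
    rw [h0, List.append_nil] at h5
    apply ha
    rw [← mk_toWord (x := a), ← h5, ← mul_mk, ← inv_mk, mul_inv_cancel]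
  rw [h1] at h3
  simp [List.replicate, invRev_length] at h2 h3
  unfold norm at *
  omega

/-- The inverse of a letter of a word. -/
def letterInv {ι : Type*} (p : ι × Bool) : ι × Bool := (p.1, !p.2)

/-- If the images of the letters are Nielsen reduced then the length of words does not drop. -/
theorem length_le_norm_prod {ι : Type*} (f : ι × Bool → FreeGroup α) (hf1 : ∀ p, f p ≠ 1)
    (hN1 : ∀ p q, p ≠ letterInv q → 2 * lcp (f p)⁻¹ (f q) ≤ norm (f q))
    (hN2 : ∀ p q r, p ≠ letterInv q → q ≠ letterInv r →
      lcp (f p)⁻¹ (f q) + lcp (f q)⁻¹ (f r) < norm (f q))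
    (q : ι × Bool) (l : List (ι × Bool)) (hl : IsReduced (q :: l)) :
    (∀ p, p ≠ letterInv q →
      lcp (f p)⁻¹ ((q :: l).map f).prod = lcp (f p)⁻¹ (f q)) ∧
    (∀ p, p ≠ letterInv q →
      (q :: l).length + lcp (f p)⁻¹ (f q) ≤ norm ((q :: l).map f).prod) := by
  induction l generalizing q with
  | nil =>
    refine ⟨by simp, fun p hp => ?_⟩
    have h1 := hN1 p q hp
    have h2 : norm (f q) ≠ 0 := fun h => hf1 q (norm_eq_zero.1 h)
    simp
    omega
  | cons r l ih =>
    obtain ⟨hqr, hrl⟩ := isReduced_cons_cons.1 hl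
    have hqr' : q ≠ letterInv r := by
      rintro rfl
      simp [letterInv] at hqr
    obtain ⟨ih1, ih2⟩ := ih r hrl
    have e1 := ih1 q hqr'
    have e2 := ih2 q hqr'
    rw [List.map_cons, List.prod_cons]
    set W := ((r :: l).map f).prod
    have e3 := norm_mul_add (f q) W
    have e4 := norm_inv_mul_add (f q) (f q * W)
    rw [inv_mul_cancel_left] at e4
    refine ⟨fun p hp => ?_, fun p hp => ?_⟩
    · have e5 := hN2 p q r hp hqr'
      have e6 := lcp_min_le (f p)⁻¹ (f q) (f q * W)
      have e7 := lcp_min_le (f p)⁻¹ (f q * W) (f q)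
      rw [lcp_comm (f q * W) (f q)] at e7
      omega
    · have e5 := hN2 p q r hp hqr'
      simp only [List.length_cons] at e2 ⊢
      omega

/-- A set of pairs of elements which is stable under Nielsen moves and simultaneous conjugation. -/
structure NielsenStable {G : Type*} [Group G] (S : G → G → Prop) : Prop where
  swap : ∀ {a b}, S a b → S b a
  inv : ∀ {a b}, S a b → S a⁻¹ b
  mul : ∀ {a b}, S a b → S (a * b) b
  conj : ∀ {a b} (g), S a b → S (g * a * g⁻¹) (g * b * g⁻¹)

theorem NielsenStable.two_mul_lcp_le {S : FreeGroup α → FreeGroup α → Prop}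
    (hS : NielsenStable S) {a b : FreeGroup α} (hab : S a b)
    (hmin : ∀ c d, S c d → norm a + norm b ≤ norm c + norm d) :
    2 * lcp a⁻¹ b ≤ norm a ∧ 2 * lcp a⁻¹ b ≤ norm b := by
  have h1 := norm_mul_add a b
  have h2 := hmin _ _ (hS.mul hab)
  have h3 := hmin _ _ (hS.inv (hS.mul (hS.inv (hS.swap (hS.inv hab)))))
  have h4 : (b⁻¹ * a⁻¹)⁻¹ = a * b := by group
  rw [h4, norm_inv_eq] at h3
  omega

theorem NielsenStable.lcp_add_lcp_lt {S : FreeGroup α → FreeGroup α → Prop}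
    (hS : NielsenStable S) {a b : FreeGroup α} (hab : S a b) (ha : a ≠ 1) (hb : b ≠ 1)
    (hmin : ∀ c d, S c d → norm a + norm b ≤ norm c + norm d) :
    lcp a⁻¹ b + lcp b⁻¹ a < norm b := by
  by_contra! hlt
  have hb0 : norm b ≠ 0 := fun h => hb (norm_eq_zero.1 h)
  obtain ⟨h1, h2⟩ := hS.two_mul_lcp_le hab hmin
  obtain ⟨h3, h4⟩ := hS.two_mul_lcp_le (hS.swap hab) (by simpa only [add_comm] using hmin)
  have hw := norm_mul_add a b
  obtain ⟨z, hz, hza⟩ := exists_norm_one_lcp ha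
  have e1 := lcp_min_le z a b⁻¹
  rw [lcp_comm a b⁻¹] at e1
  set w := a * b with hwdef
  have e2 := norm_inv_mul_add a w
  rw [show a⁻¹ * w = b by rw [hwdef]; group] at e2
  have e3 := lcp_min_le z a w
  have e4 := norm_inv_mul_add w⁻¹ b⁻¹
  rw [show w⁻¹⁻¹ * b⁻¹ = a by rw [hwdef]; group, norm_inv_eq, norm_inv_eq] at e4
  have e5 := lcp_min_le z b⁻¹ w⁻¹
  rw [lcp_comm b⁻¹ w⁻¹] at e5
  have e6 := norm_inv_mul_add w z
  rw [lcp_comm w z] at e6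
  have e7 := norm_inv_mul_add (w⁻¹ * z) w⁻¹
  rw [show (w⁻¹ * z)⁻¹ * w⁻¹ = z⁻¹ by group, norm_inv_eq, norm_inv_eq] at e7
  have e8 := norm_mul_le z (w⁻¹ * z)⁻¹
  rw [show z * (w⁻¹ * z)⁻¹ = w by group, norm_inv_eq] at e8
  have e9 := lcp_min_le (w⁻¹ * z) w⁻¹ z
  rw [lcp_comm w⁻¹ z] at e9
  have e10 := norm_inv_mul_add (w⁻¹ * z) z
  rw [show (w⁻¹ * z)⁻¹ * z = z⁻¹ * w * z⁻¹⁻¹ by group] at e10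
  have e11 := norm_mul_add b z
  rw [lcp_comm b⁻¹ z] at e11
  have e12 := norm_mul_le z⁻¹ (b * z)
  rw [show z⁻¹ * (b * z) = z⁻¹ * b * z⁻¹⁻¹ by group, norm_inv_eq] at e12
  have e13 := hmin _ _ (hS.conj z⁻¹ (hS.mul hab))
  rw [← hwdef] at e13
  omega

theorem NielsenStable.lcp_add_lcp_inv_lt {S : FreeGroup α → FreeGroup α → Prop}
    (hS : NielsenStable S) {a b : FreeGroup α} (hab : S a b) (hb : b ≠ 1)
    (hmin : ∀ c d, S c d → norm a + norm b ≤ norm c + norm d) :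
    lcp a⁻¹ b + lcp b⁻¹ a⁻¹ < norm b := by
  obtain ⟨h1, h2⟩ := hS.two_mul_lcp_le hab hmin
  obtain ⟨h3, h4⟩ := hS.two_mul_lcp_le (hS.swap (hS.inv hab))
    (by simpa only [add_comm, norm_inv_eq] using hmin)
  have e1 := lcp_min_le b⁻¹ a⁻¹ b
  have e2 := two_mul_lcp_inv_self_lt hb
  omega

/-- The letter `p` evaluated at the pair `(u, v)`. -/
def evalLetter {G : Type*} [Group G] (u v : G) (p : Fin 2 × Bool) : G :=
  cond p.2 (![u, v] p.1) (![u, v] p.1)⁻¹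

theorem NielsenStable.norm_le_norm_lift {S : FreeGroup α → FreeGroup α → Prop}
    (hS : NielsenStable S) {u v : FreeGroup α} (huv : S u v) (hu : u ≠ 1) (hv : v ≠ 1)
    (hmin : ∀ c d, S c d → norm u + norm v ≤ norm c + norm d) (w : FreeGroup (Fin 2)) :
    norm w ≤ norm (lift ![u, v] w) := by
  set f := evalLetter u v with hf
  have hnorm : ∀ i b, norm (f (i, b)) = norm (![u, v] i) := by
    intro i b
    cases b <;> simp [hf, evalLetter, norm_inv_eq]
  have hinv : ∀ p, f (letterInv p) = (f p)⁻¹ := by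
    rintro ⟨i, b⟩
    cases b <;> simp [hf, evalLetter, letterInv]
  have hSf : ∀ p q : Fin 2 × Bool, p.1 ≠ q.1 → S (f p) (f q) := by
    have h1 := hS.inv huv
    have h2 := hS.swap (hS.inv (hS.swap huv))
    have h3 := hS.inv h2
    rintro ⟨i, b⟩ ⟨j, c⟩ hij
    fin_cases i <;> fin_cases j <;> cases b <;> cases c <;>
      first
      | exact absurd rfl hij
      | simpa [hf, evalLetter] using huv
      | simpa [hf, evalLetter] using h1
      | simpa [hf, evalLetter] using h2
      | simpa [hf, evalLetter] using h3
      | simpa [hf, evalLetter] using hS.swap huv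
      | simpa [hf, evalLetter] using hS.swap h1
      | simpa [hf, evalLetter] using hS.swap h2
      | simpa [hf, evalLetter] using hS.swap h3
  have hminf : ∀ p q : Fin 2 × Bool, p.1 ≠ q.1 → ∀ c d, S c d →
      norm (f p) + norm (f q) ≤ norm c + norm d := by
    rintro ⟨i, b⟩ ⟨j, c⟩ hij c' d' hS'
    have := hmin _ _ hS'
    rw [hnorm, hnorm]
    fin_cases i <;> fin_cases j <;> simp at hij ⊢ <;> omega
  have hf1 : ∀ p, f p ≠ 1 := by
    rintro ⟨i, b⟩
    fin_cases i <;> cases b <;> simpa [hf, evalLetter]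
  have hcase : ∀ p q : Fin 2 × Bool, p ≠ letterInv q → p.1 = q.1 → p = q := by
    decide
  have hcase' : ∀ p q r : Fin 2 × Bool, p.1 ≠ q.1 → q.1 ≠ r.1 → r = p ∨ r = letterInv p := by
    decide
  have hN1 : ∀ p q, p ≠ letterInv q →
      2 * lcp (f p)⁻¹ (f q) ≤ norm (f q) ∧ 2 * lcp (f p)⁻¹ (f q) ≤ norm (f p) := by
    intro p q hpq
    by_cases h : p.1 = q.1
    · obtain rfl := hcase p q hpq h
      have := two_mul_lcp_inv_self_lt (hf1 p)
      omega
    · exact (hS.two_mul_lcp_le (hSf p q h) (hminf p q h)).symm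
  have hN2 : ∀ p q r, p ≠ letterInv q → q ≠ letterInv r →
      lcp (f p)⁻¹ (f q) + lcp (f q)⁻¹ (f r) < norm (f q) := by
    intro p q r hpq hqr
    have h1 := (hN1 p q hpq).1
    have h2 := (hN1 q r hqr).2
    have h3 := two_mul_lcp_inv_self_lt (hf1 q)
    by_cases h : p.1 = q.1
    · obtain rfl := hcase p q hpq h
      omega
    by_cases h' : q.1 = r.1
    · obtain rfl := hcase q r hqr h'
      omega
    rcases hcase' p q r h h' with rfl | rfl
    · exact hS.lcp_add_lcp_lt (hSf _ _ h) (hf1 _) (hf1 _) (hminf _ _ h)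
    · rw [hinv]
      exact hS.lcp_add_lcp_inv_lt (hSf _ _ h) (hf1 _) (hminf _ _ h)
  have hw : lift ![u, v] w = (w.toWord.map f).prod := by
    conv_lhs => rw [← mk_toWord (x := w)]
    rw [lift_mk]
    rfl
  rw [hw, norm]
  have hred := isReduced_toWord (x := w)
  generalize w.toWord = L at hred ⊢
  rcases L with _ | ⟨q, l⟩
  · simp
  · have hq : ∀ q : Fin 2 × Bool, q ≠ letterInv q := by decide
    have := (length_le_norm_prod f hf1 (fun p q h => (hN1 p q h).1) hN2 q l hred).2 q (hq q)
    omega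

end FreeGroup

section

open FreeGroup

/-- The pairs obtained from `(x^±1, y^±1)` by swaps and positive Nielsen moves. -/
inductive PosPair : F2 → F2 → Prop
  | base {a b : F2} (ha : a = xg ∨ a = xg⁻¹) (hb : b = yg ∨ b = yg⁻¹) : PosPair a b
  | swap {a b : F2} (h : PosPair a b) : PosPair b a
  | mul {a b : F2} (h : PosPair a b) : PosPair (a * b) b

/-- The pairs which are, up to inverses and simultaneous conjugation, a `PosPair`. -/
def ConjPosPair (u v : F2) : Prop :=
  ∃ g a b, PosPair a b ∧ (u = g * a * g⁻¹ ∨ u = g * a⁻¹ * g⁻¹) ∧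
    (v = g * b * g⁻¹ ∨ v = g * b⁻¹ * g⁻¹)

theorem ConjPosPair.swap {u v : F2} (h : ConjPosPair u v) : ConjPosPair v u := by
  obtain ⟨g, a, b, hab, hu, hv⟩ := h
  exact ⟨g, b, a, hab.swap, hv, hu⟩

theorem ConjPosPair.inv {u v : F2} (h : ConjPosPair u v) : ConjPosPair u⁻¹ v := by
  obtain ⟨g, a, b, hab, rfl | rfl, hv⟩ := h
  · exact ⟨g, a, b, hab, Or.inr (by group), hv⟩
  · exact ⟨g, a, b, hab, Or.inl (by group), hv⟩

theorem ConjPosPair.conj {u v : F2} (c : F2) (h : ConjPosPair u v) :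
    ConjPosPair (c * u * c⁻¹) (c * v * c⁻¹) := by
  obtain ⟨g, a, b, hab, hu, hv⟩ := h
  refine ⟨c * g, a, b, hab, hu.imp ?_ ?_, hv.imp ?_ ?_⟩ <;> rintro rfl <;> group

theorem ConjPosPair.of_conj {u v : F2} (c : F2)
    (h : ConjPosPair (c * u * c⁻¹) (c * v * c⁻¹)) : ConjPosPair u v := by
  have := h.conj c⁻¹
  rwa [show c⁻¹ * (c * u * c⁻¹) * c⁻¹⁻¹ = u by group,
    show c⁻¹ * (c * v * c⁻¹) * c⁻¹⁻¹ = v by group] at this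

theorem PosPair.conjPosPair {a b : F2} (h : PosPair a b) : ConjPosPair a b :=
  ⟨1, a, b, h, Or.inl (by simp), Or.inl (by simp)⟩

theorem PosPair.conjPosPair_mul_inv {a b : F2} (h : PosPair a b) :
    ConjPosPair (a * b⁻¹) b ∧ ConjPosPair (b * a⁻¹) a := by
  induction h with
  | @base a b ha hb =>
    have ha' : a⁻¹ = xg ∨ a⁻¹ = xg⁻¹ := by
      rcases ha with rfl | rfl <;> simp
    have hb' : b⁻¹ = yg ∨ b⁻¹ = yg⁻¹ := by
      rcases hb with rfl | rfl <;> simp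
    have h1 := (PosPair.mul (PosPair.base ha hb')).conjPosPair
    have h2 := (PosPair.mul (PosPair.swap (PosPair.base ha' hb))).conjPosPair
    have h3 := h1.swap.inv.swap
    have h4 := h2.swap.inv.swap
    rw [inv_inv] at h3 h4
    exact ⟨h3, h4⟩
  | swap _ ih => exact ih.symm
  | @mul a b h _ =>
    constructor
    · simpa using h.conjPosPair
    · have h1 : ConjPosPair (a * b) a := by
        refine ConjPosPair.of_conj a⁻¹ ?_
        rw [show a⁻¹ * (a * b) * a⁻¹⁻¹ = b * a by group,
          show a⁻¹ * a * a⁻¹⁻¹ = a by group]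
        exact (PosPair.mul h.swap).conjPosPair
      rw [show b * (a * b)⁻¹ = a⁻¹ by group]
      exact h1.swap.inv

theorem ConjPosPair.mul {u v : F2} (h : ConjPosPair u v) : ConjPosPair (u * v) v := by
  obtain ⟨g, a, b, hab, rfl | rfl, rfl | rfl⟩ := h
  · refine ConjPosPair.of_conj g⁻¹ ?_
    convert hab.mul.conjPosPair using 1 <;> group
  · refine ConjPosPair.of_conj g⁻¹ ?_
    convert hab.conjPosPair_mul_inv.1.swap.inv.swap using 1 <;> group
  · refine ConjPosPair.of_conj (b * g⁻¹) ?_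
    convert hab.conjPosPair_mul_inv.1.inv using 1 <;> group
  · refine ConjPosPair.of_conj (b⁻¹ * g⁻¹) ?_
    convert hab.mul.conjPosPair.inv.swap.inv.swap using 1 <;> group

theorem nielsenStable_lift_surjective :
    NielsenStable fun u v : F2 => Function.Surjective (lift ![u, v] : F2 →* F2) := by
  have key : ∀ u v u' v' : F2, u ∈ (lift ![u', v'] : F2 →* F2).range →
      v ∈ (lift ![u', v'] : F2 →* F2).range →
      Function.Surjective (lift ![u, v] : F2 →* F2) →
      Function.Surjective (lift ![u', v'] : F2 →* F2) := by
    intro u v u' v' hu hv h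
    rw [← MonoidHom.range_eq_top] at h ⊢
    rw [eq_top_iff, ← h]
    exact range_lift_le (by rintro _ ⟨i, rfl⟩; fin_cases i <;> assumption)
  have hm : ∀ u v : F2, u ∈ (lift ![u, v] : F2 →* F2).range ∧
      v ∈ (lift ![u, v] : F2 →* F2).range :=
    fun u v => ⟨⟨xg, by simp [xg]⟩, ⟨yg, by simp [yg]⟩⟩
  refine ⟨fun {a b} h => ?_, fun {a b} h => ?_, fun {a b} h => ?_, fun {a b} g h => ?_⟩
  · exact key _ _ _ _ (hm b a).2 (hm b a).1 h
  · exact key _ _ _ _ (by simpa using inv_mem (hm a⁻¹ b).1) (hm a⁻¹ b).2 h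
  · exact key _ _ _ _ (by simpa using mul_mem (hm (a * b) b).1 (inv_mem (hm (a * b) b).2))
      (hm (a * b) b).2 h
  · have : (lift ![g * a * g⁻¹, g * b * g⁻¹] : F2 →* F2) =
        (MulAut.conj g).toMonoidHom.comp (lift ![a, b]) := by
      ext i
      fin_cases i <;> simp
    rw [this]
    exact (MulAut.conj g).surjective.comp h

theorem eq_generator_of_norm_le_one {w : F2} (h : FreeGroup.norm w ≤ 1) :
    w = 1 ∨ w = xg ∨ w = xg⁻¹ ∨ w = yg ∨ w = yg⁻¹ := by
  rw [← mk_toWord (x := w)]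
  rw [FreeGroup.norm] at h
  generalize w.toWord = L at h ⊢
  rcases L with _ | ⟨⟨i, b⟩, _ | ⟨q, l⟩⟩
  · exact Or.inl rfl
  · fin_cases i <;> cases b
    · exact Or.inr (Or.inr (Or.inl rfl))
    · exact Or.inr (Or.inl rfl)
    · exact Or.inr (Or.inr (Or.inr (Or.inr rfl)))
    · exact Or.inr (Or.inr (Or.inr (Or.inl rfl)))
  · simp at h

theorem xg_mul_yg_ne : xg * yg ≠ yg * xg := by
  decide

/-- Nielsen's theorem: a generating pair of `F₂` arises from `(x, y)` by Nielsen moves. -/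
theorem conjPosPair_of_surjective {u v : F2}
    (h : Function.Surjective (lift ![u, v] : F2 →* F2)) : ConjPosPair u v := by
  by_contra hP
  set S : F2 → F2 → Prop := fun u v =>
    Function.Surjective (lift ![u, v] : F2 →* F2) ∧ ¬ ConjPosPair u v
  have hS : NielsenStable S := by
    have h0 := nielsenStable_lift_surjective
    refine ⟨fun h => ⟨h0.swap h.1, fun hc => h.2 hc.swap⟩,
      fun h => ⟨h0.inv h.1, fun hc => h.2 (by simpa using hc.inv)⟩,
      fun {a b} h => ⟨h0.mul h.1, fun hc => h.2 ?_⟩,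
      fun g h => ⟨h0.conj g h.1, fun hc => h.2 (hc.of_conj g)⟩⟩
    simpa using hc.swap.inv.swap.mul.swap.inv.swap
  have hex : ∃ n, ∃ u v, S u v ∧ FreeGroup.norm u + FreeGroup.norm v = n :=
    ⟨_, u, v, ⟨h, hP⟩, rfl⟩
  classical
  obtain ⟨u, v, huv, hn⟩ := Nat.find_spec hex
  have hmin : ∀ c d, S c d →
      FreeGroup.norm u + FreeGroup.norm v ≤ FreeGroup.norm c + FreeGroup.norm d :=
    fun c d hcd => hn ▸ Nat.find_min' hex ⟨c, d, hcd, rfl⟩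
  have hcomm : ¬ ∀ w w' : F2, Commute (lift ![u, v] w) (lift ![u, v] w') := by
    intro hc
    obtain ⟨w, hw⟩ := huv.1 xg
    obtain ⟨w', hw'⟩ := huv.1 yg
    exact xg_mul_yg_ne (by simpa [hw, hw'] using (hc w w').eq)
  have hzp : ∀ t : F2, (∀ i, ![u, v] i ∈ Subgroup.zpowers t) → False := by
    intro t ht
    apply hcomm
    have hr : ∀ w, (lift ![u, v] : F2 →* F2) w ∈ Subgroup.zpowers t := by
      exact fun w => range_lift_le (s := Subgroup.zpowers t)
        (by rintro _ ⟨i, rfl⟩; exact ht i) ⟨w, rfl⟩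
    intro w w'
    obtain ⟨i, hi⟩ := hr w
    obtain ⟨j, hj⟩ := hr w'
    simp only at hi hj
    rw [← hi, ← hj]
    exact Commute.zpow_zpow_self t i j
  have hu : u ≠ 1 := by
    rintro rfl
    refine hzp v fun i => ?_
    fin_cases i <;> simp
  have hv : v ≠ 1 := by
    rintro rfl
    refine hzp u fun i => ?_
    fin_cases i <;> simp
  have key := hS.norm_le_norm_lift huv hu hv hmin
  obtain ⟨w, hw⟩ := huv.1 xg
  obtain ⟨w', hw'⟩ := huv.1 yg
  have hxy := xg_mul_yg_ne
  have hw1 := eq_generator_of_norm_le_one ((key w).trans_eq (by rw [hw]; exact norm_of _))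
  have hw1' := eq_generator_of_norm_le_one ((key w').trans_eq (by rw [hw']; exact norm_of _))
  apply huv.2
  have hx1 : xg ≠ 1 := of_ne_one _
  have hy1 : yg ≠ 1 := of_ne_one _
  have hX : (lift ![u, v] : F2 →* F2) xg = u := by simp [xg]
  have hY : (lift ![u, v] : F2 →* F2) yg = v := by simp [yg]
  have c1 : ∀ {a b : F2}, (a = xg ∨ a = xg⁻¹) → (b = yg ∨ b = yg⁻¹) → ConjPosPair a b :=
    fun ha hb => (PosPair.base ha hb).conjPosPair
  rcases hw1 with rfl | rfl | rfl | rfl | rfl <;>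
  rcases hw1' with rfl | rfl | rfl | rfl | rfl <;>
  simp only [_root_.map_one, _root_.map_inv, hX, hY] at hw hw' <;>
  first
  | exact absurd hw.symm hx1
  | exact absurd hw'.symm hy1
  | (refine absurd ?_ hxy; rw [← hw, ← hw']; done)
  | (refine absurd ?_ hxy; rw [← hw, ← hw']; group; done)
  | (refine c1 ?_ ?_ <;> (simp [← hw, ← hw']; done))
  | (refine ConjPosPair.swap (c1 (a := v) (b := u) ?_ ?_) <;> simp [← hw, ← hw'])

/-- A normal form for the words with at most one letter `y^δ` among those in which all
letters `y^±1` have the same sign `δ`. -/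
def SignedWord (δ : ℤ) (w : F2) : Prop :=
  0 ≤ δ * (expSum 1 w).toAdd ∧ ((expSum 1 w).toAdd = 0 → ∃ i : ℤ, w = xg ^ i) ∧
    ((expSum 1 w).toAdd = δ → ∃ i j : ℤ, w = xg ^ i * yg ^ δ * xg ^ j)

theorem SignedWord.mul {δ : ℤ} (hδ : δ = 1 ∨ δ = -1) {a b : F2} (ha : SignedWord δ a)
    (hb : SignedWord δ b) : SignedWord δ (a * b) := by
  obtain ⟨ha1, ha2, ha3⟩ := ha
  obtain ⟨hb1, hb2, hb3⟩ := hb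
  simp only [SignedWord, _root_.map_mul, toAdd_mul]
  refine ⟨by linarith, fun h => ?_, fun h => ?_⟩
  · have h1 : (expSum 1 a).toAdd = 0 := by rcases hδ with rfl | rfl <;> omega
    have h2 : (expSum 1 b).toAdd = 0 := by rcases hδ with rfl | rfl <;> omega
    obtain ⟨i, rfl⟩ := ha2 h1
    obtain ⟨j, rfl⟩ := hb2 h2
    exact ⟨i + j, (zpow_add _ _ _).symm⟩
  · have h1 : ((expSum 1 a).toAdd = 0 ∧ (expSum 1 b).toAdd = δ) ∨
        ((expSum 1 a).toAdd = δ ∧ (expSum 1 b).toAdd = 0) := by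
      rcases hδ with rfl | rfl <;> omega
    rcases h1 with ⟨h1, h2⟩ | ⟨h1, h2⟩
    · obtain ⟨i, rfl⟩ := ha2 h1
      obtain ⟨j, k, rfl⟩ := hb3 h2
      exact ⟨i + j, k, by group⟩
    · obtain ⟨i, j, rfl⟩ := ha3 h1
      obtain ⟨k, rfl⟩ := hb2 h2
      exact ⟨i, j + k, by group⟩

@[simp] theorem expSum_xg_zero : expSum 0 xg = Multiplicative.ofAdd 1 := by simp [expSum, xg]
@[simp] theorem expSum_xg_one : expSum 1 xg = 1 := by simp [expSum, xg]
@[simp] theorem expSum_yg_zero : expSum 0 yg = 1 := by simp [expSum, yg]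
@[simp] theorem expSum_yg_one : expSum 1 yg = Multiplicative.ofAdd 1 := by simp [expSum, yg]

theorem PosPair.exists_signedWord {a b : F2} (h : PosPair a b) :
    ∃ δ : ℤ, (δ = 1 ∨ δ = -1) ∧ SignedWord δ a ∧ SignedWord δ b := by
  induction h with
  | @base a b ha hb =>
    have hx : ∀ δ : ℤ, (δ = 1 ∨ δ = -1) → SignedWord δ a := by
      rintro δ hδ
      rcases ha with rfl | rfl
      · refine ⟨by simp, fun _ => ⟨1, by simp⟩, fun h => ?_⟩
        simp at h
        omega
      · refine ⟨by simp, fun _ => ⟨-1, by simp⟩, fun h => ?_⟩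
        simp at h
        omega
    rcases hb with rfl | rfl
    · exact ⟨1, Or.inl rfl, hx 1 (Or.inl rfl), by simp, by simp, fun _ => ⟨0, 0, by simp⟩⟩
    · exact ⟨-1, Or.inr rfl, hx _ (Or.inr rfl), by simp, by simp, fun _ => ⟨0, 0, by simp⟩⟩
  | swap _ ih =>
    obtain ⟨δ, hδ, h1, h2⟩ := ih
    exact ⟨δ, hδ, h2, h1⟩
  | mul _ ih =>
    obtain ⟨δ, hδ, h1, h2⟩ := ih
    exact ⟨δ, hδ, h1.mul hδ h2, h2⟩

/-- Automorphisms of `F₂` inducing a transvection are, up to inner automorphisms, the obvious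
ones. -/
theorem exists_conj_of_autMat {γ : F2 ≃* F2} {a : ℤ} (h : autMat γ = !![1, a; 0, 1]) :
    ∃ g : F2, γ xg = g * xg * g⁻¹ ∧ γ yg = g * (yg * xg ^ a) * g⁻¹ := by
  have hx0 : (expSum 0 (γ xg)).toAdd = 1 := congrFun (congrFun h 0) 0
  have hx1 : (expSum 1 (γ xg)).toAdd = 0 := congrFun (congrFun h 1) 0
  have hy0 : (expSum 0 (γ yg)).toAdd = a := congrFun (congrFun h 0) 1
  have hy1 : (expSum 1 (γ yg)).toAdd = 1 := congrFun (congrFun h 1) 1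
  have hlift : lift ![γ xg, γ yg] = γ.toMonoidHom := by
    ext i
    fin_cases i <;> simp [xg, yg]
  obtain ⟨g, u, v, huv, hu, hv⟩ :=
    conjPosPair_of_surjective (u := γ xg) (v := γ yg) (by rw [hlift]; exact γ.surjective)
  obtain ⟨δ, hδ, hsu, hsv⟩ := huv.exists_signedWord
  have hX : γ xg = g * xg * g⁻¹ := by
    have hu1 : (expSum 1 u).toAdd = 0 := by
      rcases hu with hu | hu <;> rw [hu] at hx1 <;> simpa using hx1
    obtain ⟨i, rfl⟩ := hsu.2.1 hu1
    rcases hu with hu | hu <;> rw [hu] at hx0 ⊢ <;> simp at hx0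
    · simp [hx0]
    · simp [show i = -1 by omega]
  have hY : ∃ i j : ℤ, γ yg = g * (xg ^ i * yg * xg ^ j) * g⁻¹ := by
    have hsv1 := hsv.1
    rcases hv with hv | hv <;> rw [hv] at hy1 ⊢ <;> simp at hy1
    · obtain rfl : δ = 1 := by
        rcases hδ with rfl | rfl
        · rfl
        · omega
      obtain ⟨i, j, rfl⟩ := hsv.2.2 hy1
      exact ⟨i, j, by simp⟩
    · obtain rfl : δ = -1 := by
        rcases hδ with rfl | rfl
        · omega
        · rfl
      obtain ⟨i, j, rfl⟩ := hsv.2.2 (by omega)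
      exact ⟨-j, -i, by group⟩
  obtain ⟨i, j, hY⟩ := hY
  have hij : i + j = a := by
    rw [hY] at hy0
    simpa using hy0
  refine ⟨g * xg ^ i, ?_, ?_⟩
  · rw [hX]
    group
  · rw [hY, ← hij]
    group

/-- The permutation by which `x` acts on the squares of the origami of `Hₙ`. -/
def permX (n : ℕ) : Equiv.Perm (Fin 4 × ZMod n) where
  toFun
    | (0, k) => (1, k)
    | (1, k) => (2, k)
    | (2, k) => (0, k + 1)
    | (3, k) => (3, k)
  invFun
    | (0, k) => (2, k - 1)
    | (1, k) => (0, k)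
    | (2, k) => (1, k)
    | (3, k) => (3, k)
  left_inv := by
    rintro ⟨i, k⟩
    fin_cases i <;> simp
  right_inv := by
    rintro ⟨i, k⟩
    fin_cases i <;> simp

/-- The permutation by which `y` acts on the squares of the origami of `Hₙ`. -/
def permY (n : ℕ) : Equiv.Perm (Fin 4 × ZMod n) :=
  (Equiv.swap 0 3).prodCongr (Equiv.refl _)

/-- The monodromy action of `F₂` on the squares of the origami of `Hₙ`. -/
def monodromy (n : ℕ) : F2 →* Equiv.Perm (Fin 4 × ZMod n) :=
  lift ![permX n, permY n]

theorem monodromy_xg (n : ℕ) : monodromy n xg = permX n := by simp [monodromy, xg]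
theorem monodromy_yg (n : ℕ) : monodromy n yg = permY n := by simp [monodromy, yg]

theorem permX_apply (n : ℕ) (k : ZMod n) : permX n (0, k) = (1, k) ∧ permX n (1, k) = (2, k) ∧
    permX n (2, k) = (0, k + 1) ∧ permX n (3, k) = (3, k) := ⟨rfl, rfl, rfl, rfl⟩

theorem permX_symm_apply (n : ℕ) (k : ZMod n) : (permX n).symm (0, k) = (2, k - 1) ∧
    (permX n).symm (1, k) = (0, k) ∧ (permX n).symm (2, k) = (1, k) ∧
    (permX n).symm (3, k) = (3, k) :=
  ⟨rfl, rfl, rfl, rfl⟩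

theorem permY_apply (n : ℕ) (k : ZMod n) : permY n (0, k) = (3, k) ∧ permY n (1, k) = (1, k) ∧
    permY n (2, k) = (2, k) ∧ permY n (3, k) = (0, k) := ⟨rfl, rfl, rfl, rfl⟩

theorem permY_inv (n : ℕ) : (permY n)⁻¹ = permY n := by
  ext1 ⟨i, k⟩
  fin_cases i <;> rfl

theorem permX_pow_apply (n m : ℕ) (i : Fin 4) (k : ZMod n) :
    (permX n ^ (3 * m)) (i, k) = (i, if i = 3 then k else k + m) := by
  have h3 : ∀ k, (permX n ^ 3) (i, k) = (i, if i = 3 then k else k + 1) := by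
    intro k
    fin_cases i <;> simp [pow_succ, permX_apply]
  rw [pow_mul]
  induction m generalizing k with
  | zero => simp
  | succ m ih =>
    rw [pow_succ, Equiv.Perm.mul_apply, h3, ih]
    split_ifs
    · rfl
    · push_cast
      ring_nf

theorem permX_pow_self (n : ℕ) : permX n ^ (3 * n) = 1 := by
  ext1 ⟨i, k⟩
  simp [permX_pow_apply]

theorem xg_pow_mem_UL : xg ^ 3 ∈ UL := Subgroup.subset_closure (by simp)

theorem conj_yg_mem_UL : xg * yg * xg⁻¹ ∈ UL := Subgroup.subset_closure (by simp)

theorem conj_sq_yg_mem_UL : xg ^ 2 * yg * (xg ^ 2)⁻¹ ∈ UL := Subgroup.subset_closure (by simp)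

theorem conj_xg_mem_UL : yg * xg * yg⁻¹ ∈ UL := Subgroup.subset_closure (by simp)

theorem yg_pow_mem_UL : yg ^ 2 ∈ UL := Subgroup.subset_closure (by simp)

/-- Representatives of the cosets of `U_L`. -/
def cosetRep : Fin 4 → F2 := ![1, xg, xg ^ 2, yg]

theorem cosetRep_mem_UL (n : ℕ) (w : F2) (p : Fin 4 × ZMod n) :
    (cosetRep (monodromy n w p).1)⁻¹ * w * cosetRep p.1 ∈ UL := by
  have hinv : ∀ w : F2,
      (∀ p : Fin 4 × ZMod n, (cosetRep (monodromy n w p).1)⁻¹ * w * cosetRep p.1 ∈ UL) →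
      ∀ p : Fin 4 × ZMod n, (cosetRep (monodromy n w⁻¹ p).1)⁻¹ * w⁻¹ * cosetRep p.1 ∈ UL := by
    intro w h p
    have h1 := inv_mem (h (monodromy n w⁻¹ p))
    rw [_root_.map_inv, show monodromy n w ((monodromy n w)⁻¹ p) = p from
      Equiv.apply_symm_apply _ p] at h1
    rw [_root_.map_inv]
    convert h1 using 1
    group
  have hof : ∀ (j : Fin 2) (p : Fin 4 × ZMod n),
      (cosetRep (monodromy n (of j) p).1)⁻¹ * of j * cosetRep p.1 ∈ UL := by
    rintro j ⟨i, k⟩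
    have hx := monodromy_xg n
    have hy := monodromy_yg n
    have h1 := xg_pow_mem_UL
    have h2 := conj_yg_mem_UL
    have h3 := conj_sq_yg_mem_UL
    have h4 := conj_xg_mem_UL
    have h5 := yg_pow_mem_UL
    obtain rfl | rfl : j = 0 ∨ j = 1 := by omega
    · change (cosetRep (monodromy n xg (i, k)).1)⁻¹ * xg * cosetRep i ∈ UL
      rw [hx]
      obtain rfl | rfl | rfl | rfl : i = 0 ∨ i = 1 ∨ i = 2 ∨ i = 3 := by omega
      · rw [(permX_apply n k).1]
        simp [cosetRep]
      · rw [(permX_apply n k).2.1]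
        convert one_mem UL using 1
        simp [cosetRep]
        group
      · rw [(permX_apply n k).2.2.1]
        simpa [cosetRep, ← pow_succ'] using h1
      · rw [(permX_apply n k).2.2.2]
        convert mul_mem (mul_mem (inv_mem h5) h4) h5 using 1
        simp [cosetRep]
        group
    · change (cosetRep (monodromy n yg (i, k)).1)⁻¹ * yg * cosetRep i ∈ UL
      rw [hy]
      obtain rfl | rfl | rfl | rfl : i = 0 ∨ i = 1 ∨ i = 2 ∨ i = 3 := by omega
      · rw [(permY_apply n k).1]
        simp [cosetRep]
      · rw [(permY_apply n k).2.1]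
        convert mul_mem (mul_mem (inv_mem h1) h3) h1 using 1
        simp [cosetRep]
        group
      · rw [(permY_apply n k).2.2.1]
        convert mul_mem (mul_mem (inv_mem h1) h2) h1 using 1
        simp [cosetRep]
        group
      · rw [(permY_apply n k).2.2.2]
        simpa [cosetRep, ← sq] using h5
  induction w using FreeGroup.induction_on generalizing p with
  | C1 => simp
  | of j => exact hof j p
  | inv_of j _ => exact hinv _ (hof j) p
  | mul a b iha ihb =>
    have := mul_mem (iha (monodromy n b p)) (ihb p)
    rw [_root_.map_mul, Equiv.Perm.mul_apply]
    convert this using 1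
    group

/-- The defining property of the homomorphism `α` on the basis of `U_L`. -/
structure IsXCubeCount (α : UL →* Multiplicative ℤ) : Prop where
  xg_pow : α ⟨xg ^ 3, xg_pow_mem_UL⟩ = Multiplicative.ofAdd 1
  conj_yg : α ⟨xg * yg * xg⁻¹, conj_yg_mem_UL⟩ = 1
  conj_sq_yg : α ⟨xg ^ 2 * yg * (xg ^ 2)⁻¹, conj_sq_yg_mem_UL⟩ = 1
  conj_xg : α ⟨yg * xg * yg⁻¹, conj_xg_mem_UL⟩ = 1
  yg_pow : α ⟨yg ^ 2, yg_pow_mem_UL⟩ = 1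

section IsXCubeCount

variable {α : UL →* Multiplicative ℤ}

theorem IsXCubeCount.monodromy_apply (hα : IsXCubeCount α) (n : ℕ) (u : UL) (k : ZMod n) :
    monodromy n u (0, k) = (0, k + ((α u).toAdd : ZMod n)) := by
  obtain ⟨w, hw⟩ := u
  suffices h : ∀ w ∈ UL, ∃ hw : w ∈ UL, ∀ k : ZMod n,
      monodromy n w (0, k) = (0, k + ((α ⟨w, hw⟩).toAdd : ZMod n)) from (h w hw).2 k
  intro w hw
  induction hw using Subgroup.closure_induction with
  | mem w hw =>
    simp only [Set.mem_insert_iff, Set.mem_singleton_iff] at hw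
    rcases hw with rfl | rfl | rfl | rfl | rfl
    · refine ⟨xg_pow_mem_UL, fun k => ?_⟩
      rw [hα.xg_pow]
      simp [monodromy_xg, pow_succ, permX_apply]
    · refine ⟨conj_yg_mem_UL, fun k => ?_⟩
      rw [hα.conj_yg]
      simp [monodromy_xg, monodromy_yg, permX_apply, permX_symm_apply, permY_apply]
    · refine ⟨conj_sq_yg_mem_UL, fun k => ?_⟩
      rw [hα.conj_sq_yg]
      simp [monodromy_xg, monodromy_yg, permX_apply, permX_symm_apply, permY_apply, sq]
    · refine ⟨conj_xg_mem_UL, fun k => ?_⟩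
      rw [hα.conj_xg]
      simp [monodromy_xg, monodromy_yg, permX_apply, permY_inv, permY_apply]
    · refine ⟨yg_pow_mem_UL, fun k => ?_⟩
      rw [hα.yg_pow]
      simp [monodromy_yg, permY_apply, sq]
  | one => exact ⟨one_mem UL, fun k => by simp [show α ⟨1, one_mem UL⟩ = 1 from _root_.map_one α]⟩
  | mul a b _ _ iha ihb =>
    obtain ⟨ha, iha⟩ := iha
    obtain ⟨hb, ihb⟩ := ihb
    refine ⟨mul_mem ha hb, fun k => ?_⟩
    rw [show α ⟨a * b, mul_mem ha hb⟩ = α ⟨a, ha⟩ * α ⟨b, hb⟩ from _root_.map_mul α ⟨a, ha⟩ ⟨b, hb⟩,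
      _root_.map_mul, Equiv.Perm.mul_apply, ihb, iha, toAdd_mul]
    push_cast
    ring_nf
  | inv a _ iha =>
    obtain ⟨ha, iha⟩ := iha
    refine ⟨inv_mem ha, fun k => ?_⟩
    rw [show α ⟨a⁻¹, inv_mem ha⟩ = (α ⟨a, ha⟩)⁻¹ from _root_.map_inv α ⟨a, ha⟩,
      _root_.map_inv, Equiv.Perm.inv_eq_iff_eq, iha, toAdd_inv]
    push_cast
    ring_nf

theorem IsXCubeCount.mem_Hgrp_iff (hα : IsXCubeCount α) (n : ℕ) (w : F2) :
    w ∈ Hgrp α n ↔ monodromy n w (0, 0) = (0, 0) := by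
  have hdvd : ∀ hw : w ∈ UL, (n : ℤ) ∣ (α ⟨w, hw⟩).toAdd ↔ monodromy n w (0, 0) = (0, 0) := by
    intro hw
    rw [show monodromy n w (0, 0) = _ from hα.monodromy_apply n ⟨w, hw⟩ 0,
      ← ZMod.intCast_zmod_eq_zero_iff_dvd]
    simp
  constructor
  · rintro ⟨⟨w, hw⟩, h, rfl⟩
    exact (hdvd hw).1 h
  · intro h
    have hw : w ∈ UL := by
      have := cosetRep_mem_UL n w (0, 0)
      rw [h] at this
      simpa [cosetRep] using this
    exact ⟨⟨w, hw⟩, (hdvd hw).2 h, rfl⟩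

theorem IsXCubeCount.transvection_mem_VeechGroup (hα : IsXCubeCount α) {n : ℕ} {A : SL2Z}
    (hA : (A : Matrix (Fin 2) (Fin 2) ℤ) = !![1, ((3 * n : ℕ) : ℤ); 0, 1]) :
    A ∈ VeechGroup (Hgrp α n) := by
  let f : ℤ → F2 →* F2 := fun a => lift ![xg, yg * xg ^ a]
  have hf : ∀ a, f a xg = xg ∧ f a yg = yg * xg ^ a := fun a => by simp [f, xg, yg]
  have hcomp : ∀ a, (f a).comp (f (-a)) = MonoidHom.id F2 := by
    intro a
    ext i
    fin_cases i
    · change f a (f (-a) xg) = xg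
      simp [hf]
    · change f a (f (-a) yg) = yg
      simp [hf]
  let γ : F2 ≃* F2 := MonoidHom.toMulEquiv (f (3 * n : ℕ)) (f (-(3 * n : ℕ)))
    (by simpa using hcomp (-(3 * n : ℕ))) (hcomp _)
  have hγx : γ xg = xg := (hf (3 * n : ℕ)).1
  have hγy : γ yg = yg * xg ^ ((3 * n : ℕ) : ℤ) := (hf (3 * n : ℕ)).2
  have hmat : autMat γ = !![1, ((3 * n : ℕ) : ℤ); 0, 1] := by
    ext i j
    fin_cases j
    · change (expSum i (γ xg)).toAdd = _
      rw [hγx]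
      fin_cases i <;> simp
    · change (expSum i (γ yg)).toAdd = _
      rw [hγy]
      fin_cases i <;> simp
  have hmon : (monodromy n).comp γ.toMonoidHom = monodromy n := by
    ext1 i
    fin_cases i
    · change monodromy n (γ xg) = monodromy n xg
      rw [hγx]
    · change monodromy n (γ yg) = monodromy n yg
      rw [hγy, _root_.map_mul, zpow_natCast, _root_.map_pow, monodromy_xg, permX_pow_self, mul_one]
  refine ⟨γ, ⟨by simp [hmat], ?_⟩, hA.trans hmat.symm⟩
  have hiff : ∀ w, γ w ∈ Hgrp α n ↔ w ∈ Hgrp α n := by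
    intro w
    rw [hα.mem_Hgrp_iff, hα.mem_Hgrp_iff]
    exact Eq.congr_left (congrArg (fun f : F2 →* Equiv.Perm (Fin 4 × ZMod n) => f w (0, 0)) hmon)
  ext w
  constructor
  · rintro ⟨v, hv, rfl⟩
    exact (hiff v).2 hv
  · intro hw
    refine ⟨γ.symm w, (hiff _).1 ?_, γ.apply_symm_apply w⟩
    rwa [γ.apply_symm_apply]

theorem IsXCubeCount.dvd_of_transvection_mem_VeechGroup (hα : IsXCubeCount α) {n m : ℕ} {A : SL2Z}
    (hA : (A : Matrix (Fin 2) (Fin 2) ℤ) = !![1, ((3 * m : ℕ) : ℤ); 0, 1])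
    (h : A ∈ VeechGroup (Hgrp α n)) : n ∣ m := by
  obtain ⟨γ, ⟨-, hγ⟩, hmat⟩ := h
  obtain ⟨g, hx, hy⟩ := exists_conj_of_autMat (hmat.symm.trans hA)
  have hmem := hα.mem_Hgrp_iff n
  have hiff : ∀ w, γ w ∈ Hgrp α n ↔ w ∈ Hgrp α n := by
    intro w
    constructor
    · intro hw
      rw [← hγ] at hw
      obtain ⟨v, hv, hvw⟩ := hw
      rwa [← γ.injective hvw]
    · intro hw
      rw [← hγ]
      exact ⟨w, hw, rfl⟩
  set X := permX n
  set Y := permY n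
  set s := (monodromy n g)⁻¹ (0, 0) with hs
  have hfix : ∀ w v : F2, γ w = g * v * g⁻¹ → w ∈ Hgrp α n → monodromy n v s = s := by
    intro w v hwv hw
    have h1 := (hmem _).1 ((hiff w).2 hw)
    rw [hwv] at h1
    simp only [_root_.map_mul, _root_.map_inv, Equiv.Perm.mul_apply] at h1
    rw [← Equiv.Perm.eq_inv_iff_eq] at h1
    exact h1
  have hxs : X s ≠ s := by
    intro h1
    have h2 : monodromy n (γ xg) (0, 0) = (0, 0) := by
      rw [hx]
      simp only [_root_.map_mul, _root_.map_inv, Equiv.Perm.mul_apply, monodromy_xg]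
      rw [← hs, h1]
      exact Equiv.apply_symm_apply _ _
    rw [← hmem, hiff, hmem, monodromy_xg, (permX_apply n 0).1] at h2
    simp at h2
  have hH : ∀ j : ℕ, j = 1 ∨ j = 2 → Y ((X ^ (3 * m)) ((X ^ j) s)) = (X ^ j) s := by
    intro j hj
    have h1 := hfix ((xg ^ j)⁻¹ * yg * xg ^ j) ((xg ^ j)⁻¹ * (yg * xg ^ (3 * m)) * xg ^ j)
      (by simp only [_root_.map_mul, _root_.map_inv, _root_.map_pow, hx, hy, conj_pow, zpow_natCast]
          group) ?_
    · simp only [_root_.map_mul, _root_.map_inv, _root_.map_pow, monodromy_xg, monodromy_yg,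
        Equiv.Perm.mul_apply, Equiv.Perm.inv_eq_iff_eq] at h1
      exact h1
    · rw [hmem]
      rcases hj with rfl | rfl <;>
      simp [monodromy_xg, monodromy_yg, permX_apply, permY_apply, permX_symm_apply, sq]
  have key : ∀ (i : Fin 4) (k : ZMod n), i = 1 ∨ i = 2 → Y ((X ^ (3 * m)) (i, k)) = (i, k) →
      n ∣ m := by
    intro i k hi h1
    rw [← ZMod.natCast_eq_zero_iff]
    rw [permX_pow_apply] at h1
    rcases hi with rfl | rfl <;> simpa [Y, permY_apply] using h1
  obtain ⟨i, k⟩ := s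
  have h1 := hH 1 (Or.inl rfl)
  have h2 := hH 2 (Or.inr rfl)
  obtain rfl | rfl | rfl | rfl : i = 0 ∨ i = 1 ∨ i = 2 ∨ i = 3 := by omega
  · exact key 1 k (Or.inl rfl) h1
  · exact key 2 k (Or.inr rfl) h1
  · exact key 1 (k + 1) (Or.inl rfl) h2
  · exact absurd rfl hxs

end IsXCubeCount

end

/-- For the subgroups `Hₙ` built from `U_L` as in Setting A, the Veech groups are pairwise
distinct: `Γ(Hₙ) ≠ Γ(H_m)` for `n ≠ m` (`n, m ≥ 1`). -/
theorem UL_veech_Hn_pairwise_distinct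
    (α : UL →* Multiplicative ℤ)
    (hα1 : ∀ hm : xg ^ 3 ∈ UL, α ⟨xg ^ 3, hm⟩ = Multiplicative.ofAdd 1)
    (hα2 : ∀ hm : xg * yg * xg⁻¹ ∈ UL, α ⟨xg * yg * xg⁻¹, hm⟩ = 1)
    (hα3 : ∀ hm : xg ^ 2 * yg * (xg ^ 2)⁻¹ ∈ UL, α ⟨xg ^ 2 * yg * (xg ^ 2)⁻¹, hm⟩ = 1)
    (hα4 : ∀ hm : yg * xg * yg⁻¹ ∈ UL, α ⟨yg * xg * yg⁻¹, hm⟩ = 1)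
    (hα5 : ∀ hm : yg ^ 2 ∈ UL, α ⟨yg ^ 2, hm⟩ = 1)
    : ∀ n m : ℕ, 1 ≤ n → 1 ≤ m → n ≠ m →
      VeechGroup (Hgrp α n) ≠ VeechGroup (Hgrp α m) := by
  have hα : IsXCubeCount α := ⟨hα1 _, hα2 _, hα3 _, hα4 _, hα5 _⟩
  have hdvd : ∀ n m : ℕ, VeechGroup (Hgrp α n) = VeechGroup (Hgrp α m) → n ∣ m := by
    intro n m h
    let A : SL2Z := ⟨!![1, ((3 * m : ℕ) : ℤ); 0, 1], by simp⟩
    have hA : A ∈ VeechGroup (Hgrp α m) := hα.transvection_mem_VeechGroup rfl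
    exact hα.dvd_of_transvection_mem_VeechGroup rfl (h ▸ hA)
  intro n m _ _ hnm h
  exact hnm (Nat.dvd_antisymm (hdvd n m h) (hdvd m n h.symm))
end

section
/- For U_L as in Setting A with H₀ := ker α, the Veech group Γ(H₀) contains the matrix [[1,0],[2,1]] and has infinite index in SL₂(ℤ); in particular Γ(H₀) is nontrivial. -/
/-! ### The matrix of an automorphism -/

theorem toAdd_expSum_apply (γ : F2 ≃* F2) (i : Fin 2) (g : F2) :
    (expSum i (γ g)).toAdd = ∑ k, autMat γ i k * (expSum k g).toAdd := by
  induction g using FreeGroup.induction_on with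
  | C1 => simp
  | of j => simp [autMat, expSum]
  | inv_of j h => rw [map_inv, map_inv, toAdd_inv, h]; simp
  | mul a b ha hb => simp [ha, hb, mul_add, Finset.sum_add_distrib]

theorem autMat_trans (γ δ : F2 ≃* F2) : autMat (δ.trans γ) = autMat γ * autMat δ := by
  ext i j
  rw [Matrix.mul_apply]
  exact toAdd_expSum_apply γ i (δ (FreeGroup.of j))

theorem autMat_refl : autMat (MulEquiv.refl F2) = 1 := by
  ext i j
  simp [autMat, expSum, Matrix.one_apply, eq_comm]

theorem autMat_symm_mul (γ : F2 ≃* F2) : autMat γ.symm * autMat γ = 1 := by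
  rw [← autMat_trans, MulEquiv.self_trans_symm, autMat_refl]

/-- The Veech group of `V` as a subgroup of `SL₂(ℤ)`. -/
def veechSubgroup (V : Subgroup F2) : Subgroup SL2Z where
  carrier := VeechGroup V
  one_mem' := ⟨MulEquiv.refl F2, ⟨by simp [autMat_refl], Subgroup.map_id V⟩, autMat_refl.symm⟩
  mul_mem' := by
    rintro A B ⟨γ, ⟨hγ, hγV⟩, hA⟩ ⟨δ, ⟨hδ, hδV⟩, hB⟩
    refine ⟨δ.trans γ, ⟨by rw [autMat_trans, Matrix.det_mul, hγ, hδ, one_mul], ?_⟩, ?_⟩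
    · have h : (δ.trans γ).toMonoidHom = γ.toMonoidHom.comp δ.toMonoidHom := rfl
      rw [h, ← Subgroup.map_map, hδV, hγV]
    · rw [autMat_trans, ← hA, ← hB, Matrix.SpecialLinearGroup.coe_mul]
  inv_mem' := by
    rintro A ⟨γ, ⟨hγ, hγV⟩, hA⟩
    have h := autMat_symm_mul γ
    refine ⟨γ.symm, ⟨by simpa [hγ] using congrArg Matrix.det h, ?_⟩, ?_⟩
    · conv_lhs => rw [← hγV]
      rw [Subgroup.map_map]
      convert Subgroup.map_id V
      ext g : 1
      simp
    · rw [← hA] at h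
      calc ((A⁻¹ : SL2Z) : Matrix (Fin 2) (Fin 2) ℤ)
          = autMat γ.symm * ((A * A⁻¹ : SL2Z) : Matrix (Fin 2) (Fin 2) ℤ) * 1 := by
            rw [Matrix.SpecialLinearGroup.coe_mul, ← mul_assoc, h, one_mul, mul_one]
        _ = autMat γ.symm := by simp

/-! ### Elements of a subgroup with a prescribed value of a character -/

/-- `g` lies in `U` and `α g = n`. -/
def HasValue {U : Subgroup F2} (α : U →* Multiplicative ℤ) (g : F2) (n : ℤ) : Prop :=
  ∃ h : g ∈ U, α ⟨g, h⟩ = Multiplicative.ofAdd n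

namespace HasValue

variable {U : Subgroup F2} {α : U →* Multiplicative ℤ} {g h : F2} {m n : ℤ}

theorem one : HasValue α 1 0 := ⟨one_mem U, map_one α⟩

theorem mul (hg : HasValue α g m) (hh : HasValue α h n) : HasValue α (g * h) (m + n) := by
  obtain ⟨hg, eg⟩ := hg
  obtain ⟨hh, eh⟩ := hh
  refine ⟨mul_mem hg hh, ?_⟩
  rw [ofAdd_add, ← eg, ← eh, ← map_mul]; rfl

theorem inv (hg : HasValue α g m) : HasValue α g⁻¹ (-m) := by
  obtain ⟨hg, eg⟩ := hg
  refine ⟨inv_mem hg, ?_⟩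
  rw [ofAdd_neg, ← eg, ← map_inv]; rfl

theorem unique (hm : HasValue α g m) (hn : HasValue α g n) : m = n := by
  obtain ⟨h, e⟩ := hm
  obtain ⟨h', e'⟩ := hn
  exact Multiplicative.ofAdd.injective (e.symm.trans e')

theorem conj (hg : HasValue α g m) (hh : HasValue α h n) : HasValue α (g * h * g⁻¹) n := by
  have := (hg.mul hh).mul hg.inv
  rwa [show m + n + -m = n by ring] at this

theorem pow (hg : HasValue α g m) (k : ℕ) : HasValue α (g ^ k) (k * m) := by
  induction k with
  | zero => simpa using one
  | succ k ih =>
    rw [pow_succ]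
    convert ih.mul hg using 1
    push_cast; ring

theorem pow_zero (hg : HasValue α g 0) (k : ℕ) : HasValue α (g ^ k) 0 := by
  simpa using hg.pow k

end HasValue

theorem mem_Hgrp_zero {U : Subgroup F2} (α : U →* Multiplicative ℤ) (g : F2) :
    g ∈ Hgrp α 0 ↔ HasValue α g 0 := by
  constructor
  · rintro ⟨⟨u, hu⟩, h, rfl⟩
    exact ⟨hu, Multiplicative.toAdd.injective (zero_dvd_iff.mp h)⟩
  · rintro ⟨hg, h⟩
    refine ⟨⟨g, hg⟩, ?_, rfl⟩
    change ((0 : ℕ) : ℤ) ∣ (α ⟨g, hg⟩).toAdd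
    simp [h]

/-! ### The transfer of a character along a transversal -/

/-- Right multiplication by `g` permutes the cosets `U rᵢ` by `σ`, and the values of `α` on the
corresponding factors `rᵢ g r_{σ i}⁻¹` are the `a i`. -/
def CosetCocycle {U : Subgroup F2} (α : U →* Multiplicative ℤ) (r : Fin 4 → F2) (g : F2)
    (σ : Equiv.Perm (Fin 4)) (a : Fin 4 → ℤ) : Prop :=
  ∀ i, HasValue α (r i * g * (r (σ i))⁻¹) (a i)

namespace CosetCocycle

variable {U : Subgroup F2} {α : U →* Multiplicative ℤ} {r : Fin 4 → F2} {g h : F2}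
  {σ τ : Equiv.Perm (Fin 4)} {a b : Fin 4 → ℤ}

theorem one : CosetCocycle α r 1 1 0 := fun i => by simpa using HasValue.one

theorem mul (hg : CosetCocycle α r g σ a) (hh : CosetCocycle α r h τ b) :
    CosetCocycle α r (g * h) (τ * σ) fun i => a i + b (σ i) := fun i => by
  convert (hg i).mul (hh (σ i)) using 1
  rw [Equiv.Perm.mul_apply]; group

theorem inv (hg : CosetCocycle α r g σ a) :
    CosetCocycle α r g⁻¹ σ⁻¹ fun i => -a (σ⁻¹ i) := fun i => by
  convert (hg (σ⁻¹ i)).inv using 1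
  simp [mul_assoc]

theorem pow (hg : CosetCocycle α r g σ a) (k : ℕ) :
    ∃ b, CosetCocycle α r (g ^ k) (σ ^ k) b ∧ ∑ i, b i = k * ∑ i, a i := by
  induction k with
  | zero => exact ⟨0, by simpa using one, by simp⟩
  | succ k ih =>
    obtain ⟨b, hb, e⟩ := ih
    refine ⟨_, by rw [pow_succ, pow_succ']; exact hb.mul hg, ?_⟩
    rw [Finset.sum_add_distrib, e, Equiv.sum_comp (σ ^ k) a]
    push_cast; ring

end CosetCocycle

/-- Coset representatives of `U_L` in `F₂`. -/
def repL : Fin 4 → F2 := ![1, xg, xg ^ 2, yg]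

theorem exists_cosetCocycle_repL {α : UL →* Multiplicative ℤ}
    (h1 : HasValue α (xg ^ 3) 1) (h2 : HasValue α (xg * yg * xg⁻¹) 0)
    (h3 : HasValue α (xg ^ 2 * yg * (xg ^ 2)⁻¹) 0) (h4 : HasValue α (yg * xg * yg⁻¹) 0)
    (h5 : HasValue α (yg ^ 2) 0) (g : F2) :
    ∃ σ a, CosetCocycle α repL g σ a ∧ ∑ i, a i = (expSum 0 g).toAdd := by
  induction g using FreeGroup.induction_on with
  | C1 => exact ⟨1, 0, CosetCocycle.one, by simp⟩
  | of j =>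
    fin_cases j
    · refine ⟨Equiv.swap 0 1 * Equiv.swap 1 2, ![0, 0, 1, 0], fun i => ?_, ?_⟩
      · change HasValue α (repL i * xg * _) _
        fin_cases i
        · convert HasValue.one using 1
          · simp [repL, Equiv.swap_apply_def]
          · rfl
        · convert HasValue.one using 1
          · simp [repL, Equiv.swap_apply_def, pow_two]
          · rfl
        · convert h1 using 1
          · simp [repL, pow_succ]
          · rfl
        · exact h4
      · simp [expSum, Fin.sum_univ_four]
    · refine ⟨Equiv.swap 0 3, 0, fun i => ?_, ?_⟩
      · change HasValue α (repL i * yg * _) _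
        fin_cases i
        · convert HasValue.one using 1
          · simp [repL]
          · rfl
        · exact h2
        · exact h3
        · convert h5 using 1
          · simp [repL, pow_two]
          · rfl
      · simp [expSum]
  | inv_of j ih =>
    obtain ⟨σ, a, h, e⟩ := ih
    refine ⟨_, _, h.inv, ?_⟩
    rw [Equiv.sum_comp σ⁻¹ fun i => -a i, Finset.sum_neg_distrib, e, map_inv, toAdd_inv]
  | mul g g' ih ih' =>
    obtain ⟨σ, a, h, e⟩ := ih
    obtain ⟨σ', a', h', e'⟩ := ih'
    refine ⟨_, _, h.mul h', ?_⟩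
    rw [Finset.sum_add_distrib, Equiv.sum_comp σ a', e, e', map_mul, toAdd_mul]

theorem hasValue_conj_yg_sq {α : UL →* Multiplicative ℤ}
    (h1 : HasValue α (xg ^ 3) 1) (h2 : HasValue α (xg * yg * xg⁻¹) 0)
    (h3 : HasValue α (xg ^ 2 * yg * (xg ^ 2)⁻¹) 0) (h4 : HasValue α (yg * xg * yg⁻¹) 0)
    (h5 : HasValue α (yg ^ 2) 0) (g : F2) : HasValue α (g * yg ^ 2 * g⁻¹) 0 := by
  obtain ⟨σ, a, h, -⟩ := exists_cosetCocycle_repL h1 h2 h3 h4 h5 g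
  have hrep : ∀ j, HasValue α (repL j * yg ^ 2 * (repL j)⁻¹) 0 := by
    intro j
    fin_cases j
    · simpa [repL] using h5
    · convert h2.pow_zero 2 using 1
      simp [repL, conj_pow]
    · convert h3.pow_zero 2 using 1
      simp [repL, conj_pow]
    · convert h5 using 1
      simp [repL, pow_two, mul_assoc]
  convert (h 0).conj (hrep (σ 0)) using 1
  simp [repL, mul_assoc]

theorem expSum_eq_zero_of_hasValue_conj {α : UL →* Multiplicative ℤ}
    (h1 : HasValue α (xg ^ 3) 1) (h2 : HasValue α (xg * yg * xg⁻¹) 0)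
    (h3 : HasValue α (xg ^ 2 * yg * (xg ^ 2)⁻¹) 0) (h4 : HasValue α (yg * xg * yg⁻¹) 0)
    (h5 : HasValue α (yg ^ 2) 0) {w : F2}
    (hw : ∀ g, HasValue α (g * w ^ 2 * g⁻¹) 0) : (expSum 0 w).toAdd = 0 := by
  obtain ⟨σ, a, h, e⟩ := exists_cosetCocycle_repL h1 h2 h3 h4 h5 w
  obtain ⟨b, hb, eb⟩ := h.pow 24
  have hσ : σ ^ 24 = 1 := by
    have := pow_card_eq_one (x := σ)
    rwa [Fintype.card_perm, Fintype.card_fin] at this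
  have hzero : ∀ i, b i = 0 := fun i => by
    refine (hb i).unique ?_
    convert (hw (repL i)).pow_zero 12 using 1
    rw [hσ, conj_pow, ← pow_mul]; rfl
  simp only [hzero, e, Finset.sum_const_zero] at eb
  simpa using eb.symm

theorem autMat_zero_one_eq_zero {α : UL →* Multiplicative ℤ}
    (h1 : HasValue α (xg ^ 3) 1) (h2 : HasValue α (xg * yg * xg⁻¹) 0)
    (h3 : HasValue α (xg ^ 2 * yg * (xg ^ 2)⁻¹) 0) (h4 : HasValue α (yg * xg * yg⁻¹) 0)
    (h5 : HasValue α (yg ^ 2) 0) {γ : F2 ≃* F2}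
    (hγ : Subgroup.map γ.toMonoidHom (Hgrp α 0) = Hgrp α 0) : autMat γ 0 1 = 0 := by
  refine expSum_eq_zero_of_hasValue_conj h1 h2 h3 h4 h5 (w := γ yg) fun g => ?_
  rw [← mem_Hgrp_zero, ← hγ]
  refine ⟨γ.symm g * yg ^ 2 * (γ.symm g)⁻¹,
    (mem_Hgrp_zero α _).2 (hasValue_conj_yg_sq h1 h2 h3 h4 h5 _), ?_⟩
  simp

theorem map_Hgrp_le {α : UL →* Multiplicative ℤ}
    (h1 : HasValue α (xg ^ 3) 1) (h2 : HasValue α (xg * yg * xg⁻¹) 0)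
    (h3 : HasValue α (xg ^ 2 * yg * (xg ^ 2)⁻¹) 0) (h4 : HasValue α (yg * xg * yg⁻¹) 0)
    (h5 : HasValue α (yg ^ 2) 0) (f : F2 →* F2)
    (f1 : HasValue α (f (xg ^ 3)) 1) (f2 : HasValue α (f (xg * yg * xg⁻¹)) 0)
    (f3 : HasValue α (f (xg ^ 2 * yg * (xg ^ 2)⁻¹)) 0) (f4 : HasValue α (f (yg * xg * yg⁻¹)) 0)
    (f5 : HasValue α (f (yg ^ 2)) 0) : Subgroup.map f (Hgrp α 0) ≤ Hgrp α 0 := by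
  have key : ∀ g ∈ UL, ∃ n, HasValue α g n ∧ HasValue α (f g) n := by
    intro g hg
    induction hg using Subgroup.closure_induction with
    | mem g hg =>
      rcases hg with rfl | rfl | rfl | rfl | rfl
      exacts [⟨1, h1, f1⟩, ⟨0, h2, f2⟩, ⟨0, h3, f3⟩, ⟨0, h4, f4⟩, ⟨0, h5, f5⟩]
    | one => exact ⟨0, HasValue.one, by simpa using HasValue.one⟩
    | mul g g' _ _ ih ih' =>
      obtain ⟨m, hm, hm'⟩ := ih
      obtain ⟨n, hn, hn'⟩ := ih'
      exact ⟨m + n, hm.mul hn, by simpa using hm'.mul hn'⟩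
    | inv g _ ih =>
      obtain ⟨m, hm, hm'⟩ := ih
      exact ⟨-m, hm.inv, by simpa using hm'.inv⟩
  rintro _ ⟨g, hg, rfl⟩
  have hg := (mem_Hgrp_zero α g).1 hg
  obtain ⟨n, hn, hn'⟩ := key g hg.1
  rw [hn.unique hg] at hn'
  exact (mem_Hgrp_zero α _).2 hn'

/-- The automorphism `x ↦ y² x`, `y ↦ y` of `F₂`. -/
def shear : F2 ≃* F2 :=
  MonoidHom.toMulEquiv (FreeGroup.lift ![yg ^ 2 * xg, yg]) (FreeGroup.lift ![(yg ^ 2)⁻¹ * xg, yg])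
    (by ext j; fin_cases j <;> simp [xg, yg]) (by ext j; fin_cases j <;> simp [xg, yg])

theorem shear_xg : shear xg = yg ^ 2 * xg := by simp [shear, xg]

theorem shear_yg : shear yg = yg := by simp [shear, yg]

theorem shear_symm_xg : shear.symm xg = (yg ^ 2)⁻¹ * xg := by simp [shear, xg]

theorem shear_symm_yg : shear.symm yg = yg := by simp [shear, yg]

theorem autMat_shear : autMat shear = !![1, 0; 2, 1] := by
  have hx : shear (FreeGroup.of 0) = yg ^ 2 * xg := shear_xg
  have hy : shear (FreeGroup.of 1) = yg := shear_yg
  ext i j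
  fin_cases i <;> fin_cases j <;> simp [autMat, expSum, hx, hy, xg, yg]

theorem map_shear_Hgrp {α : UL →* Multiplicative ℤ}
    (h1 : HasValue α (xg ^ 3) 1) (h2 : HasValue α (xg * yg * xg⁻¹) 0)
    (h3 : HasValue α (xg ^ 2 * yg * (xg ^ 2)⁻¹) 0) (h4 : HasValue α (yg * xg * yg⁻¹) 0)
    (h5 : HasValue α (yg ^ 2) 0) :
    Subgroup.map shear.toMonoidHom (Hgrp α 0) = Hgrp α 0 := by
  apply le_antisymm
  · apply map_Hgrp_le h1 h2 h3 h4 h5 <;>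
      simp only [MulEquiv.toMonoidHom_eq_coe, MonoidHom.coe_coe, map_mul, map_pow, map_inv,
        shear_xg, shear_yg]
    · convert ((h5.mul (h2.pow_zero 2)).mul (h3.pow_zero 2)).mul h1 using 1
      simp only [pow_succ, pow_zero]; group
    · convert h5.conj h2 using 1
      group
    · convert (h5.mul (h2.pow_zero 2)).conj h3 using 1
      simp only [pow_succ, pow_zero]; group
    · convert h5.mul h4 using 1
      group
    · exact h5
  · have hle : Subgroup.map shear.symm.toMonoidHom (Hgrp α 0) ≤ Hgrp α 0 := by
      apply map_Hgrp_le h1 h2 h3 h4 h5 <;>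
        simp only [MulEquiv.toMonoidHom_eq_coe, MonoidHom.coe_coe, map_mul, map_pow, map_inv,
          shear_symm_xg, shear_symm_yg]
      · convert ((h5.inv.mul (h2.pow_zero 2).inv).mul (h3.pow_zero 2).inv).mul h1 using 1
        simp only [pow_succ, pow_zero]; group
      · convert h5.inv.conj h2 using 1
        group
      · convert (h5.inv.mul (h2.pow_zero 2).inv).conj h3 using 1
        simp only [pow_succ, pow_zero]; group
      · convert h5.inv.mul h4 using 1
        group
      · exact h5
    intro g hg
    exact ⟨shear.symm g, hle ⟨g, hg, rfl⟩, by simp⟩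

/-- For `U_L` with `H₀ = ker α` as in Setting A: the Veech group `Γ(H₀)` contains the
matrix `[[1,0],[2,1]]`, and it is a subgroup of infinite index in `SL₂(ℤ)`; in particular
it is nontrivial. -/
theorem UL_veech_H0_infinite_index
    (α : UL →* Multiplicative ℤ)
    (hα1 : ∀ hm : xg ^ 3 ∈ UL, α ⟨xg ^ 3, hm⟩ = Multiplicative.ofAdd 1)
    (hα2 : ∀ hm : xg * yg * xg⁻¹ ∈ UL, α ⟨xg * yg * xg⁻¹, hm⟩ = 1)
    (hα3 : ∀ hm : xg ^ 2 * yg * (xg ^ 2)⁻¹ ∈ UL, α ⟨xg ^ 2 * yg * (xg ^ 2)⁻¹, hm⟩ = 1)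
    (hα4 : ∀ hm : yg * xg * yg⁻¹ ∈ UL, α ⟨yg * xg * yg⁻¹, hm⟩ = 1)
    (hα5 : ∀ hm : yg ^ 2 ∈ UL, α ⟨yg ^ 2, hm⟩ = 1)
    : (⟨!![1, 0; 2, 1], by simp [Matrix.det_fin_two_of]⟩ : SL2Z) ∈
        VeechGroup (Hgrp α 0) ∧
      ∃ Γ : Subgroup SL2Z, (Γ : Set SL2Z) = VeechGroup (Hgrp α 0) ∧
        Γ.index = 0 ∧ Γ ≠ ⊥ := by
  have hUL : ∀ g ∈ ({xg ^ 3, xg * yg * xg⁻¹, xg ^ 2 * yg * (xg ^ 2)⁻¹, yg * xg * yg⁻¹,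
      yg ^ 2} : Set F2), g ∈ UL := fun g hg => Subgroup.subset_closure hg
  have h1 : HasValue α (xg ^ 3) 1 := ⟨hUL _ (by simp), hα1 _⟩
  have h2 : HasValue α (xg * yg * xg⁻¹) 0 := ⟨hUL _ (by simp), hα2 _⟩
  have h3 : HasValue α (xg ^ 2 * yg * (xg ^ 2)⁻¹) 0 := ⟨hUL _ (by simp), hα3 _⟩
  have h4 : HasValue α (yg * xg * yg⁻¹) 0 := ⟨hUL _ (by simp), hα4 _⟩
  have h5 : HasValue α (yg ^ 2) 0 := ⟨hUL _ (by simp), hα5 _⟩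
  have hmem : (⟨!![1, 0; 2, 1], by simp [Matrix.det_fin_two_of]⟩ : SL2Z) ∈
      VeechGroup (Hgrp α 0) :=
    ⟨shear, ⟨by simp [autMat_shear], map_shear_Hgrp h1 h2 h3 h4 h5⟩, autMat_shear.symm⟩
  refine ⟨hmem, veechSubgroup (Hgrp α 0), rfl, ?_, fun hbot => ?_⟩
  · by_contra hindex
    obtain ⟨n, hn, -, γ, ⟨-, hγ⟩, hT⟩ :=
      Subgroup.exists_pow_mem_of_index_ne_zero hindex ModularGroup.T
    have h01 := autMat_zero_one_eq_zero h1 h2 h3 h4 h5 hγ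
    rw [← hT, ← zpow_natCast, ModularGroup.coe_T_zpow] at h01
    simp at h01
    omega
  · have hone := Subgroup.mem_bot.1 (hbot.le hmem)
    have h10 := congrArg (fun A : SL2Z => A.1 1 0) hone
    simp at h10
end
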